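/- Define η(x,t) = −1 and u(x,t) = 2/3 + sech²((1/√2)·(x − 20 − t)). Then η and u are smooth on ℝ² and satisfy, at every point (x,t) ∈ ℝ², the abcd Boussinesq system with parameters a = b = c = 0 and d = 1/6, that is, ∂ₜη + ∂ₓu + ∂ₓ(ηu) = 0 and ∂ₜu + ∂ₓη + ∂ₓ(u²/2) − (1/6)·∂ₓ²∂ₜu = 0. -/

import Mathlib

/-- The profile `y ↦ sech² (k y)`. -/
noncomputable def sechSq (k y : ℝ) : ℝ := (1 / Real.cosh (k * y)) ^ 2

/-- The derivative of `sechSq k`. -/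
noncomputable def sechSqDeriv (k y : ℝ) : ℝ :=
  -2 * k * Real.sinh (k * y) / Real.cosh (k * y) ^ 3

theorem contDiff_sechSq (k : ℝ) {n : WithTop ℕ∞} : ContDiff ℝ n (sechSq k) := by
  unfold sechSq
  exact (contDiff_const.div (Real.contDiff_cosh.comp (contDiff_const.mul contDiff_id))
    fun y => (Real.cosh_pos _).ne').pow 2

theorem hasDerivAt_sechSq (k y : ℝ) : HasDerivAt (sechSq k) (sechSqDeriv k y) y := by
  have hc : Real.cosh (k * y) ≠ 0 := (Real.cosh_pos _).ne'
  have hlin : HasDerivAt (fun z : ℝ => k * z) k y := by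
    simpa using (hasDerivAt_id y).const_mul k
  refine (((hasDerivAt_const y (1 : ℝ)).div hlin.cosh hc).pow 2).congr_deriv ?_
  simp only [sechSqDeriv, Pi.div_apply]
  norm_num
  field_simp

theorem hasDerivAt_sechSqDeriv (k y : ℝ) :
    HasDerivAt (sechSqDeriv k) (k ^ 2 * (4 * sechSq k y - 6 * sechSq k y ^ 2)) y := by
  have hc : Real.cosh (k * y) ≠ 0 := (Real.cosh_pos _).ne'
  have hlin : HasDerivAt (fun z : ℝ => k * z) k y := by
    simpa using (hasDerivAt_id y).const_mul k
  refine ((hlin.sinh.const_mul (-2 * k)).div (hlin.cosh.pow 3) (pow_ne_zero 3 hc)).congr_deriv ?_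
  simp only [sechSq, Pi.pow_apply]
  field_simp
  rw [Real.sinh_sq (k * y)]
  ring

/-- η ≡ -1, u a traveling sech² profile, solve the abcd system with
a = b = c = 0, d = 1/6. -/
theorem abcd_boussinesq_case5
    (η u : ℝ → ℝ → ℝ)
    (hη : ∀ x t : ℝ, η x t = -1)
    (hu : ∀ x t : ℝ, u x t =
      2 / 3 + (1 / Real.cosh (1 / Real.sqrt 2 * (x - 20 - t))) ^ 2) :
    ContDiff ℝ (⊤ : ℕ∞) (fun p : ℝ × ℝ => η p.1 p.2) ∧
    ContDiff ℝ (⊤ : ℕ∞) (fun p : ℝ × ℝ => u p.1 p.2) ∧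
    ∀ x t : ℝ,
      (deriv (fun s => η x s) t + deriv (fun y => u y t) x +
        deriv (fun y => η y t * u y t) x = 0) ∧
      (deriv (fun s => u x s) t + deriv (fun y => η y t) x +
        deriv (fun y => (u y t) ^ 2 / 2) x -
        (1 / 6 : ℝ) * iteratedDeriv 2 (fun y => deriv (fun s => u y s) t) x = 0) := by
  obtain rfl : η = fun _ _ => -1 := by
    funext x t
    exact hη x t
  obtain rfl : u = fun x t => 2 / 3 + sechSq (1 / Real.sqrt 2) (x - 20 - t) := by
    funext x t
    exact hu x t
  have hk : (1 / Real.sqrt 2) ^ 2 = 1 / 2 := by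
    rw [div_pow, Real.sq_sqrt (by norm_num), one_pow]
  generalize 1 / Real.sqrt 2 = k at hk
  have hshift (x t : ℝ) : HasDerivAt (fun y : ℝ => y - 20 - t) 1 x :=
    ((hasDerivAt_id x).sub_const 20).sub_const t
  have hx (x t : ℝ) : HasDerivAt (fun y => 2 / 3 + sechSq k (y - 20 - t))
      (sechSqDeriv k (x - 20 - t)) x := by
    simpa using ((hasDerivAt_sechSq k (x - 20 - t)).comp x (hshift x t)).const_add (2 / 3)
  have ht (x t : ℝ) : HasDerivAt (fun s => 2 / 3 + sechSq k (x - 20 - s))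
      (-sechSqDeriv k (x - 20 - t)) t := by
    simpa using ((hasDerivAt_sechSq k (x - 20 - t)).comp t
      ((hasDerivAt_id t).const_sub (x - 20))).const_add (2 / 3)
  have hxt (x t : ℝ) : HasDerivAt (fun y => -sechSqDeriv k (y - 20 - t))
      (-(2 * sechSq k (x - 20 - t) - 3 * sechSq k (x - 20 - t) ^ 2)) x := by
    refine ((hasDerivAt_sechSqDeriv k (x - 20 - t)).comp x (hshift x t)).neg.congr_deriv ?_
    rw [hk]
    ring
  have hxxt (x t : ℝ) : HasDerivAt
      (fun y => -(2 * sechSq k (y - 20 - t) - 3 * sechSq k (y - 20 - t) ^ 2))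
      (-(2 - 6 * sechSq k (x - 20 - t)) * sechSqDeriv k (x - 20 - t)) x := by
    have h : HasDerivAt (fun y => sechSq k (y - 20 - t)) (sechSqDeriv k (x - 20 - t)) x := by
      simpa [Function.comp_def] using (hasDerivAt_sechSq k (x - 20 - t)).comp x (hshift x t)
    refine ((h.const_mul 2).sub ((h.pow 2).const_mul 3)).neg.congr_deriv ?_
    norm_num
    ring
  refine ⟨contDiff_const, contDiff_const.add ((contDiff_sechSq k).comp
    ((contDiff_fst.sub contDiff_const).sub contDiff_snd)), fun x t => ⟨?_, ?_⟩⟩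
  · rw [deriv_const, (hx x t).deriv, ((hx x t).const_mul (-1)).deriv]
    ring
  · have hsq := ((hx x t).pow 2).div_const 2
    simp only [Pi.pow_apply] at hsq
    simp only [fun y => (ht y t).deriv, iteratedDeriv_succ, iteratedDeriv_zero]
    rw [funext fun y => (hxt y t).deriv, (hxxt x t).deriv, deriv_const, hsq.deriv]
    norm_num
    ring
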